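/- For n = 3, the two-generated ideal J = (fgh, g f^{2}x^{3} + h g^{2}y^{3} + f h^{2}z^{3}) of R = K[x,y,z] satisfies J · I^{(3)} = I^{(6)} = (I^{(3)})^{2}; that is, J is a homogeneous minimal reduction of I^{(3)} with reduction number one. -/

import Mathlib

open MvPolynomial

noncomputable section

/-- `f = yⁿ − zⁿ` in `K[x,y,z]` (variables `x = X 0`, `y = X 1`, `z = X 2`). -/
def pf (K : Type*) [Field K] (n : ℕ) : MvPolynomial (Fin 3) K := X 1 ^ n - X 2 ^ n

/-- `g = zⁿ − xⁿ`. -/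
def pg (K : Type*) [Field K] (n : ℕ) : MvPolynomial (Fin 3) K := X 2 ^ n - X 0 ^ n

/-- `h = xⁿ − yⁿ`. -/
def ph (K : Type*) [Field K] (n : ℕ) : MvPolynomial (Fin 3) K := X 0 ^ n - X 1 ^ n

/-- The ideal `(f, g)`. -/
def Ifg (K : Type*) [Field K] (n : ℕ) : Ideal (MvPolynomial (Fin 3) K) :=
  Ideal.span {pf K n, pg K n}

/-- The ideal `(x, y)`. -/
def Ixy (K : Type*) [Field K] : Ideal (MvPolynomial (Fin 3) K) := Ideal.span {X 0, X 1}

/-- The ideal `(y, z)`. -/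
def Iyz (K : Type*) [Field K] : Ideal (MvPolynomial (Fin 3) K) := Ideal.span {X 1, X 2}

/-- The ideal `(z, x)`. -/
def Izx (K : Type*) [Field K] : Ideal (MvPolynomial (Fin 3) K) := Ideal.span {X 2, X 0}

/-- The `m`-th symbolic power of the Fermat ideal `I = (xf, yg, zh)`:
`I^{(m)} = (f,g)^m ∩ (x,y)^m ∩ (y,z)^m ∩ (z,x)^m`. -/
def symbPow (K : Type*) [Field K] (n m : ℕ) : Ideal (MvPolynomial (Fin 3) K) :=
  Ifg K n ^ m ⊓ Ixy K ^ m ⊓ Iyz K ^ m ⊓ Izx K ^ m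

section PairIdeals

variable {R : Type*} [CommRing R]

theorem Ideal.exists_eq_mul_add_pow_mul_of_mem_span_pair_pow {a b : R} (n : ℕ) :
    ∀ {u : R}, u ∈ Ideal.span {a, b} ^ (n + 1) →
      ∃ v ∈ Ideal.span {a, b} ^ n, ∃ t, u = a * v + b ^ (n + 1) * t := by
  induction n with
  | zero =>
    intro u hu
    rw [zero_add, pow_one] at hu
    obtain ⟨s, t, rfl⟩ := Ideal.mem_span_pair.1 hu
    exact ⟨s, by simp, t, by ring⟩
  | succ n ih =>
    intro u hu
    rw [pow_succ] at hu
    refine Submodule.mul_induction_on hu ?_ ?_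
    · intro p hp c hc
      obtain ⟨v, hv, t, rfl⟩ := ih hp
      obtain ⟨α, β, rfl⟩ := Ideal.mem_span_pair.1 hc
      refine ⟨v * (α * a + β * b) + b ^ (n + 1) * (t * α), ?_, t * β, by ring⟩
      refine Ideal.add_mem _ ?_ (Ideal.mul_mem_right _ _ ?_)
      · rw [pow_succ]
        exact Ideal.mul_mem_mul hv hc
      · exact Ideal.pow_mem_pow (Ideal.subset_span (by simp)) _
    · rintro p q ⟨v, hv, t, rfl⟩ ⟨v', hv', t', rfl⟩
      exact ⟨v + v', Ideal.add_mem _ hv hv', t + t', by ring⟩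

theorem Ideal.mem_span_pair_pow_of_mul_mem [IsDomain R] [DecompositionMonoid R] {a b : R}
    (ha : a ≠ 0) (hab : IsRelPrime a b) {n : ℕ} {u : R}
    (hu : a * u ∈ Ideal.span {a, b} ^ (n + 1)) : u ∈ Ideal.span {a, b} ^ n := by
  obtain ⟨v, hv, t, h⟩ := Ideal.exists_eq_mul_add_pow_mul_of_mem_span_pair_pow n hu
  obtain ⟨c, rfl⟩ : a ∣ t :=
    (IsRelPrime.pow_right (n := n + 1) hab).dvd_of_dvd_mul_left ⟨u - v, by linear_combination -h⟩
  have hu' : u = v + b ^ n * (b * c) := mul_left_cancel₀ ha (by linear_combination h)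
  rw [hu']
  exact Ideal.add_mem _ hv
    (Ideal.mul_mem_right _ _ (Ideal.pow_mem_pow (Ideal.subset_span (by simp)) _))

theorem Ideal.exists_cube_sub_cube_dvd_of_mem_span_pair_pow_six {a b q : R}
    (hq : q ∈ Ideal.span {a, b} ^ 6) :
    ∃ v ∈ Ideal.span {a, b} ^ 3, a ^ 3 - b ^ 3 ∣ q - a ^ 3 * v := by
  obtain ⟨v₁, h₁, t₁, rfl⟩ := Ideal.exists_eq_mul_add_pow_mul_of_mem_span_pair_pow 5 hq
  obtain ⟨v₂, h₂, t₂, rfl⟩ := Ideal.exists_eq_mul_add_pow_mul_of_mem_span_pair_pow 4 h₁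
  obtain ⟨v₃, h₃, t₃, rfl⟩ := Ideal.exists_eq_mul_add_pow_mul_of_mem_span_pair_pow 3 h₂
  have ha : a ∈ Ideal.span {a, b} := Ideal.subset_span (by simp)
  have hb : b ∈ Ideal.span {a, b} := Ideal.subset_span (by simp)
  have hm : ∀ i j : ℕ, a ^ i * b ^ j ∈ Ideal.span {a, b} ^ (i + j) := fun i j => by
    rw [pow_add]
    exact Ideal.mul_mem_mul (Ideal.pow_mem_pow ha _) (Ideal.pow_mem_pow hb _)
  refine ⟨v₃ + (a ^ 2 * b ^ 1 * t₃ + a ^ 1 * b ^ 2 * t₂ + a ^ 0 * b ^ 3 * t₁), ?_,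
    -(a ^ 2 * b * t₃ + a * b ^ 2 * t₂ + b ^ 3 * t₁), by ring⟩
  exact Ideal.add_mem _ h₃ (Ideal.add_mem _ (Ideal.add_mem _ (Ideal.mul_mem_right _ _ (hm 2 1))
    (Ideal.mul_mem_right _ _ (hm 1 2))) (Ideal.mul_mem_right _ _ (hm 0 3)))

theorem Ideal.span_pair_eq_of_add_eq_zero {a b c : R} (h : a + b + c = 0) :
    Ideal.span {b, c} = Ideal.span {a, b} := by
  have hc : c = -a + b * (-1) := by linear_combination h
  rw [hc, Ideal.span_pair_add_left_mul, Ideal.span_pair_neg, Ideal.span_pair_comm]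

theorem dvd_sub_mul_of_add_eq_zero {a b c x y z s₁ s₂ s₃ p : R} (h : a + b + c = 0)
    (hp : a ∣ p - b ^ 6 * (y * s₁)) :
    a ∣ p - (b * a ^ 2 * x + c * b ^ 2 * y + a * c ^ 2 * z) *
      (b * c * b * s₁ + c * a * c * s₂ + a * b * a * s₃) := by
  obtain ⟨d, hd⟩ := hp
  obtain rfl : c = -(a + b) := by linear_combination h
  refine ⟨d - (b * a * x - b ^ 2 * y + (a + b) ^ 2 * z) *
    (b * -(a + b) * b * s₁ + -(a + b) * a * -(a + b) * s₂ + a * b * a * s₃) +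
    b ^ 3 * y * (-b ^ 2 * s₁ + (a + b) ^ 2 * s₂ + b * a * s₃), ?_⟩
  linear_combination hd

end PairIdeals

namespace MvPolynomial

section Supported

variable {σ R : Type*} [CommRing R]

theorem mul_divMonomial_single_of_mem_supported {i : σ} {q : MvPolynomial σ R}
    (hq : q ∈ supported R {i}ᶜ) (r : MvPolynomial σ R) :
    (r * q).divMonomial (Finsupp.single i 1) = r.divMonomial (Finsupp.single i 1) * q := by
  classical
  have hzero : ∀ p ∈ supported R ({i}ᶜ : Set σ), p.divMonomial (Finsupp.single i 1) = 0 := by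
    intro p hp
    ext d
    rw [coeff_divMonomial, coeff_zero]
    by_contra h
    have hi : i ∈ p.vars := (mem_vars_iff_mem_support i).2 ⟨_, mem_support_iff.2 h, by simp⟩
    exact (mem_supported.1 hp) hi rfl
  induction r using MvPolynomial.induction_on' with
  | monomial m c =>
    by_cases hm : m i = 0
    · have hmc : monomial m c ∈ supported R ({i}ᶜ : Set σ) := by
        rw [mem_supported]
        intro j hj
        obtain ⟨d, hd, hjd⟩ := (mem_vars_iff_mem_support j).1 hj
        rw [Finset.mem_singleton.1 (support_monomial_subset hd)] at hjd
        rintro rfl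
        exact Finsupp.mem_support_iff.1 hjd hm
      rw [hzero _ (mul_mem hmc hq), hzero _ hmc, zero_mul]
    · have hX : monomial m c = X i * monomial (m - Finsupp.single i 1) c := by
        rw [X, monomial_mul, one_mul, add_tsub_cancel_of_le]
        simpa [Finsupp.single_le_iff] using Nat.one_le_iff_ne_zero.2 hm
      rw [hX, mul_assoc, X_mul_divMonomial, X_mul_divMonomial]
  | add p q hp hq => rw [add_mul, add_divMonomial, add_divMonomial, hp, hq, add_mul]

theorem mem_map_supported_of_X_mul_mem {i : σ} (I : Ideal (supported R ({i}ᶜ : Set σ)))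
    {u : MvPolynomial σ R}
    (hu : X i * u ∈ I.map (algebraMap _ (MvPolynomial σ R))) :
    u ∈ I.map (algebraMap _ (MvPolynomial σ R)) := by
  have key : ∀ p ∈ I.map (algebraMap _ (MvPolynomial σ R)),
      p.divMonomial (Finsupp.single i 1) ∈ I.map (algebraMap _ (MvPolynomial σ R)) := by
    intro p hp
    suffices ∀ r : MvPolynomial σ R, (r * p).divMonomial (Finsupp.single i 1) ∈
        I.map (algebraMap _ (MvPolynomial σ R)) by simpa using this 1
    refine Submodule.span_induction ?_ ?_ ?_ ?_ hp
    · rintro _ ⟨q, hq, rfl⟩ r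
      have := mul_divMonomial_single_of_mem_supported q.2 r
      exact this ▸ Ideal.mul_mem_left _ _ (Ideal.mem_map_of_mem _ hq)
    · simp
    · intro p q _ _ hp hq r
      rw [mul_add, add_divMonomial]
      exact Ideal.add_mem _ (hp r) (hq r)
    · intro a p _ hp r
      rw [smul_eq_mul, ← mul_assoc]
      exact hp _
  simpa using key _ hu

theorem mem_map_supported_of_cube_sub_cube_mul_mem {i k : σ} {N : ℕ}
    (I : Ideal (supported R ({i}ᶜ : Set σ)))
    (hk : X k ^ N ∈ I.map (algebraMap _ (MvPolynomial σ R))) {u : MvPolynomial σ R}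
    (hu : (X k ^ 3 - X i ^ 3) * u ∈ I.map (algebraMap _ (MvPolynomial σ R))) :
    u ∈ I.map (algebraMap _ (MvPolynomial σ R)) := by
  obtain ⟨c, hc⟩ := sub_dvd_pow_sub_pow (X k ^ 3 : MvPolynomial σ R) (X i ^ 3) N
  have h : X i ^ (3 * N) * u ∈ I.map (algebraMap _ (MvPolynomial σ R)) := by
    have : X i ^ (3 * N) * u =
        X k ^ (2 * N) * u * X k ^ N - c * ((X k ^ 3 - X i ^ 3) * u) := by
      linear_combination -u * hc
    rw [this]
    exact Ideal.sub_mem _ (Ideal.mul_mem_left _ _ hk) (Ideal.mul_mem_left _ _ hu)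
  have hpow : ∀ n : ℕ, X i ^ n * u ∈ I.map (algebraMap _ (MvPolynomial σ R)) →
      u ∈ I.map (algebraMap _ (MvPolynomial σ R)) := by
    intro n
    induction n with
    | zero => simp
    | succ n ih =>
      intro h
      rw [pow_succ', mul_assoc] at h
      exact ih (mem_map_supported_of_X_mul_mem I h)
  exact hpow _ h

theorem mem_span_X_pair_pow_of_cube_sub_cube_mul_mem {i j k : σ} (hij : j ≠ i) (hik : k ≠ i)
    {n : ℕ} {u : MvPolynomial σ R}
    (hu : (X k ^ 3 - X i ^ 3) * u ∈ Ideal.span {X j, X k} ^ n) :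
    u ∈ Ideal.span {X j, X k} ^ n := by
  have hj : X j ∈ supported R ({i}ᶜ : Set σ) := Algebra.subset_adjoin ⟨j, hij, rfl⟩
  have hk : X k ∈ supported R ({i}ᶜ : Set σ) := Algebra.subset_adjoin ⟨k, hik, rfl⟩
  have hI : (Ideal.span {⟨X j, hj⟩, ⟨X k, hk⟩} ^ n : Ideal (supported R ({i}ᶜ : Set σ))).map
      (algebraMap _ (MvPolynomial σ R)) = Ideal.span {X j, X k} ^ n := by
    rw [Ideal.map_pow, Ideal.map_span, Set.image_pair]
    rfl
  rw [← hI] at hu ⊢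
  refine mem_map_supported_of_cube_sub_cube_mul_mem (N := n) _ ?_ hu
  rw [hI]
  exact Ideal.pow_mem_pow (Ideal.subset_span (by simp)) _

theorem mem_span_X_pair_pow_sup_of_cube_sub_cube_mul_mem {i j k : σ} (hij : j ≠ i) (hik : k ≠ i)
    {n : ℕ} {u : MvPolynomial σ R}
    (hu : (X k ^ 3 - X i ^ 3) * u ∈ Ideal.span {X j, X k} ^ n ⊔ Ideal.span {X j ^ 3 - X k ^ 3}) :
    u ∈ Ideal.span {X j, X k} ^ n ⊔ Ideal.span {X j ^ 3 - X k ^ 3} := by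
  have hj : X j ∈ supported R ({i}ᶜ : Set σ) := Algebra.subset_adjoin ⟨j, hij, rfl⟩
  have hk : X k ∈ supported R ({i}ᶜ : Set σ) := Algebra.subset_adjoin ⟨k, hik, rfl⟩
  have hI : (Ideal.span {⟨X j, hj⟩, ⟨X k, hk⟩} ^ n ⊔ Ideal.span {⟨X j, hj⟩ ^ 3 - ⟨X k, hk⟩ ^ 3} :
      Ideal (supported R ({i}ᶜ : Set σ))).map (algebraMap _ (MvPolynomial σ R)) =
      Ideal.span {X j, X k} ^ n ⊔ Ideal.span {X j ^ 3 - X k ^ 3} := by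
    rw [Ideal.map_sup, Ideal.map_pow, Ideal.map_span, Ideal.map_span, Set.image_pair,
      Set.image_singleton]
    rfl
  rw [← hI] at hu ⊢
  refine mem_map_supported_of_cube_sub_cube_mul_mem (N := n) _ ?_ hu
  rw [hI]
  exact Ideal.mem_sup_left (Ideal.pow_mem_pow (Ideal.subset_span (by simp)) _)

end Supported

section LinearForms

variable {σ K : Type*} [Field K]

theorem irreducible_X_sub_C_mul_X {j k : σ} (hjk : j ≠ k) (c : K) :
    Irreducible (X j - C c * X k : MvPolynomial σ K) := by
  classical
  have hc : coeff (Finsupp.single j 1) (X j - C c * X k : MvPolynomial σ K) = 1 := by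
    have hk : coeff (Finsupp.single j 1) (X k : MvPolynomial σ K) = 0 := by
      rw [coeff_X, if_neg]
      simpa [Finsupp.single_left_inj] using hjk.symm
    rw [coeff_sub, coeff_C_mul, hk, mul_zero, sub_zero, coeff_X, if_pos rfl]
  have h0 : (X j - C c * X k : MvPolynomial σ K) ≠ 0 := fun h => by simp [h] at hc
  refine irreducible_of_totalDegree_eq_one ?_ fun x hx => isUnit_of_dvd_one (hc ▸ hx _)
  exact ((isHomogeneous_X K j).sub (by simpa using (isHomogeneous_C σ c).mul (isHomogeneous_X K k))
    ).totalDegree h0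

theorem exists_cube_sub_cube_eq_mul (hζ : ∃ ζ : K, IsPrimitiveRoot ζ 3) :
    ∃ a b c : K, ∀ j k : σ, (X j ^ 3 - X k ^ 3 : MvPolynomial σ K) =
      (X j - C a * X k) * ((X j - C b * X k) * (X j - C c * X k)) := by
  obtain ⟨ζ, h⟩ := hζ
  refine ⟨1, ζ, ζ ^ 2, fun j k => ?_⟩
  have h1 : (C ζ ^ 3 : MvPolynomial σ K) = 1 := by rw [← C_pow, h.pow_eq_one, C_1]
  have h2 : (1 + C ζ + C ζ ^ 2 : MvPolynomial σ K) = 0 := by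
    have := h.geom_sum_eq_zero (by norm_num)
    simp only [Finset.sum_range_succ, Finset.sum_range_zero, zero_add, pow_zero, pow_one] at this
    rw [← C_1, ← C_pow, ← C_add, ← C_add, this, C_0]
  rw [C_1, C_pow]
  linear_combination (X k ^ 3 - X j * X k ^ 2) * h1 +
    (X j ^ 2 * X k - X j * X k ^ 2 ) * h2

theorem isRelPrime_cube_sub_cube (hζ : ∃ ζ : K, IsPrimitiveRoot ζ 3) {i j k : σ} (hij : i ≠ j)
    (hjk : j ≠ k) (hik : i ≠ k) :
    IsRelPrime (X j ^ 3 - X k ^ 3 : MvPolynomial σ K) (X k ^ 3 - X i ^ 3) := by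
  classical
  have key : ∀ c : K, IsRelPrime (X j - C c * X k : MvPolynomial σ K) (X k ^ 3 - X i ^ 3) := by
    refine fun c => (irreducible_X_sub_C_mul_X hjk c).isRelPrime_iff_not_dvd.2 ?_
    rintro ⟨q, hq⟩
    simpa [hjk, hjk.symm, hij, hij.symm, hik, hik.symm] using
      congrArg (eval fun l => if l = j then c else if l = k then 1 else 0) hq
  obtain ⟨a, b, c, h⟩ := exists_cube_sub_cube_eq_mul (σ := σ) hζ
  rw [h j k]
  exact (key a).mul_left ((key b).mul_left (key c))

theorem X_cube_sub_X_cube_ne_zero {j k : σ} (hjk : j ≠ k) :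
    (X j ^ 3 - X k ^ 3 : MvPolynomial σ K) ≠ 0 := by
  classical
  intro h
  simpa [hjk.symm] using congrArg (eval fun l => if l = j then 1 else 0) h

theorem mem_span_X_pair_pow_of_X_sub_C_mul_X_mul_mem {j k : σ} (hjk : j ≠ k) (c : K) {n : ℕ}
    {u : MvPolynomial σ K} (hu : (X j - C c * X k) * u ∈ Ideal.span {X j, X k} ^ (n + 1)) :
    u ∈ Ideal.span {X j, X k} ^ n := by
  classical
  have hirr := irreducible_X_sub_C_mul_X hjk c
  have hI : Ideal.span {X j - C c * X k, X k} = Ideal.span {X j, (X k : MvPolynomial σ K)} := by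
    rw [Ideal.span_pair_sub_mul_right]
  rw [← hI] at hu ⊢
  refine Ideal.mem_span_pair_pow_of_mul_mem hirr.ne_zero (hirr.isRelPrime_iff_not_dvd.2 ?_) hu
  rintro ⟨q, hq⟩
  simpa [hjk, hjk.symm] using congrArg (eval fun l => if l = j then c else 1) hq

theorem mem_span_X_pair_pow_of_cube_sub_cube_mul_mem_pow_add_three
    (hζ : ∃ ζ : K, IsPrimitiveRoot ζ 3) {j k : σ} (hjk : j ≠ k) {n : ℕ} {u : MvPolynomial σ K}
    (hu : (X j ^ 3 - X k ^ 3) * u ∈ Ideal.span {X j, X k} ^ (n + 3)) :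
    u ∈ Ideal.span {X j, X k} ^ n := by
  obtain ⟨a, b, c, h⟩ := exists_cube_sub_cube_eq_mul (σ := σ) hζ
  rw [h j k, mul_assoc, mul_assoc] at hu
  exact mem_span_X_pair_pow_of_X_sub_C_mul_X_mul_mem hjk c
    (mem_span_X_pair_pow_of_X_sub_C_mul_X_mul_mem hjk b
      (mem_span_X_pair_pow_of_X_sub_C_mul_X_mul_mem hjk a hu))

/-- Modulo `X j ^ 3 - X k ^ 3`, an element of the sixth powers of `(f, g)` and `(X j, X k)` is a
multiple of `g ^ 6 * X j ^ 3` with cofactor in `(X j, X k) ^ 3`. -/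
theorem exists_restriction_eq {i j k : σ} (hij : i ≠ j) (hik : i ≠ k) {p : MvPolynomial σ K}
    (hp : p ∈ Ideal.span {X j ^ 3 - X k ^ 3, X k ^ 3 - X i ^ 3} ^ 6)
    (hp' : p ∈ Ideal.span {X j, X k} ^ 6) :
    ∃ s ∈ Ideal.span {X j, X k} ^ 3,
      X j ^ 3 - X k ^ 3 ∣ p - (X k ^ 3 - X i ^ 3) ^ 6 * (X j ^ 3 * s) := by
  obtain ⟨w, -, s, rfl⟩ := Ideal.exists_eq_mul_add_pow_mul_of_mem_span_pair_pow 5 hp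
  set Q : Ideal (MvPolynomial σ K) :=
    Ideal.span {X j, X k} ^ 6 ⊔ Ideal.span {X j ^ 3 - X k ^ 3}
  have hf : X j ^ 3 - X k ^ 3 ∈ Q := Ideal.mem_sup_right (Ideal.mem_span_singleton_self _)
  have hmem : (X k ^ 3 - X i ^ 3) ^ 6 * s ∈ Q :=
    (Ideal.add_mem_iff_right _ (Ideal.mul_mem_right _ _ hf)).1 (Ideal.mem_sup_left hp')
  have hpow : ∀ n : ℕ, (X k ^ 3 - X i ^ 3) ^ n * s ∈ Q → s ∈ Q := by
    intro n
    induction n with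
    | zero => simp
    | succ n ih =>
      intro h
      rw [pow_succ', mul_assoc] at h
      exact ih (mem_span_X_pair_pow_sup_of_cube_sub_cube_mul_mem hij.symm hik.symm h)
  obtain ⟨q, hq, e, he, hqe⟩ := Submodule.mem_sup.1 (hpow 6 hmem)
  obtain ⟨d, rfl⟩ := Ideal.mem_span_singleton.1 he
  obtain ⟨v, hv, c, hc⟩ := Ideal.exists_cube_sub_cube_dvd_of_mem_span_pair_pow_six hq
  refine ⟨v, hv, w + (X k ^ 3 - X i ^ 3) ^ 6 * (c + d), ?_⟩
  linear_combination (X k ^ 3 - X i ^ 3) ^ 6 * (hc - hqe)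

/-- Dividing an element of the sixth symbolic power at the coordinate point `X j = X k = 0` by
`fgh` leaves an element of the third. -/
theorem mem_span_X_pair_pow_of_triple_mul_mem (hζ : ∃ ζ : K, IsPrimitiveRoot ζ 3) {i j k : σ}
    (hij : i ≠ j) (hjk : j ≠ k) (hik : i ≠ k) {n : ℕ} {u : MvPolynomial σ K}
    (hu : (X j ^ 3 - X k ^ 3) * (X k ^ 3 - X i ^ 3) * (X i ^ 3 - X j ^ 3) * u ∈
      Ideal.span {X j, X k} ^ (n + 3)) :
    u ∈ Ideal.span {X j, X k} ^ n := by
  refine mem_span_X_pair_pow_of_cube_sub_cube_mul_mem_pow_add_three hζ hjk ?_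
  rw [Ideal.span_pair_comm]
  refine mem_span_X_pair_pow_of_cube_sub_cube_mul_mem hik.symm hij.symm ?_
  rw [Ideal.span_pair_comm]
  refine mem_span_X_pair_pow_of_cube_sub_cube_mul_mem hij.symm hik.symm ?_
  rw [← neg_mem_iff]
  convert hu using 1
  ring

end LinearForms

end MvPolynomial

section Fermat

variable {K : Type*} [Field K]

theorem pf_add_pg_add_ph (n : ℕ) : pf K n + pg K n + ph K n = 0 := by
  simp only [pf, pg, ph]
  ring

theorem Ifg_eq_span_pg_ph (n : ℕ) : Ifg K n = Ideal.span {pg K n, ph K n} :=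
  (Ideal.span_pair_eq_of_add_eq_zero (pf_add_pg_add_ph n)).symm

theorem Ifg_eq_span_ph_pf (n : ℕ) : Ifg K n = Ideal.span {ph K n, pf K n} := by
  rw [Ifg_eq_span_pg_ph]
  refine (Ideal.span_pair_eq_of_add_eq_zero ?_).symm
  linear_combination pf_add_pg_add_ph (K := K) n

theorem pf_mem_Ifg (n : ℕ) : pf K n ∈ Ifg K n := Ideal.subset_span (by simp)

theorem pg_mem_Ifg (n : ℕ) : pg K n ∈ Ifg K n := Ideal.subset_span (by simp)

theorem ph_mem_Ifg (n : ℕ) : ph K n ∈ Ifg K n := by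
  rw [Ifg_eq_span_pg_ph]
  exact Ideal.subset_span (by simp)

theorem pf_mem_Iyz_pow (n : ℕ) : pf K n ∈ Iyz K ^ n :=
  Ideal.sub_mem _ (Ideal.pow_mem_pow (Ideal.subset_span (by simp)) _)
    (Ideal.pow_mem_pow (Ideal.subset_span (by simp)) _)

theorem pg_mem_Izx_pow (n : ℕ) : pg K n ∈ Izx K ^ n :=
  Ideal.sub_mem _ (Ideal.pow_mem_pow (Ideal.subset_span (by simp)) _)
    (Ideal.pow_mem_pow (Ideal.subset_span (by simp)) _)

theorem ph_mem_Ixy_pow (n : ℕ) : ph K n ∈ Ixy K ^ n :=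
  Ideal.sub_mem _ (Ideal.pow_mem_pow (Ideal.subset_span (by simp)) _)
    (Ideal.pow_mem_pow (Ideal.subset_span (by simp)) _)

theorem triple_mem_Ifg_pow_three {n : ℕ} {a b c : MvPolynomial (Fin 3) K} (ha : a ∈ Ifg K n)
    (hb : b ∈ Ifg K n) (hc : c ∈ Ifg K n) : a * b * c ∈ Ifg K n ^ 3 := by
  rw [pow_succ, pow_two]
  exact Ideal.mul_mem_mul (Ideal.mul_mem_mul ha hb) hc

theorem mem_symbPow {n m : ℕ} {p : MvPolynomial (Fin 3) K} :
    p ∈ symbPow K n m ↔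
      p ∈ Ifg K n ^ m ∧ p ∈ Ixy K ^ m ∧ p ∈ Iyz K ^ m ∧ p ∈ Izx K ^ m := by
  simp only [symbPow, Submodule.mem_inf, and_assoc]

theorem symbPow_mul_symbPow_le (n m l : ℕ) :
    symbPow K n m * symbPow K n l ≤ symbPow K n (m + l) := by
  rw [Ideal.mul_le]
  intro p hp q hq
  rw [mem_symbPow] at *
  simp only [pow_add]
  exact ⟨Ideal.mul_mem_mul hp.1 hq.1, Ideal.mul_mem_mul hp.2.1 hq.2.1,
    Ideal.mul_mem_mul hp.2.2.1 hq.2.2.1, Ideal.mul_mem_mul hp.2.2.2 hq.2.2.2⟩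

theorem pg_mul_ph_mul_mem_symbPow {a b : MvPolynomial (Fin 3) K} (ha : a ∈ Ifg K 3)
    (hb : b ∈ Iyz K ^ 3) : pg K 3 * ph K 3 * a * b ∈ symbPow K 3 3 :=
  mem_symbPow.2 ⟨Ideal.mul_mem_right _ _ (triple_mem_Ifg_pow_three (pg_mem_Ifg 3)
      (ph_mem_Ifg 3) ha),
    Ideal.mul_mem_right _ _ (Ideal.mul_mem_right _ _ (Ideal.mul_mem_left _ _ (ph_mem_Ixy_pow 3))),
    Ideal.mul_mem_left _ _ hb,
    Ideal.mul_mem_right _ _ (Ideal.mul_mem_right _ _ (Ideal.mul_mem_right _ _ (pg_mem_Izx_pow 3)))⟩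

theorem ph_mul_pf_mul_mem_symbPow {a b : MvPolynomial (Fin 3) K} (ha : a ∈ Ifg K 3)
    (hb : b ∈ Izx K ^ 3) : ph K 3 * pf K 3 * a * b ∈ symbPow K 3 3 :=
  mem_symbPow.2 ⟨Ideal.mul_mem_right _ _ (triple_mem_Ifg_pow_three (ph_mem_Ifg 3)
      (pf_mem_Ifg 3) ha),
    Ideal.mul_mem_right _ _ (Ideal.mul_mem_right _ _ (Ideal.mul_mem_right _ _ (ph_mem_Ixy_pow 3))),
    Ideal.mul_mem_right _ _ (Ideal.mul_mem_right _ _ (Ideal.mul_mem_left _ _ (pf_mem_Iyz_pow 3))),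
    Ideal.mul_mem_left _ _ hb⟩

theorem pf_mul_pg_mul_mem_symbPow {a b : MvPolynomial (Fin 3) K} (ha : a ∈ Ifg K 3)
    (hb : b ∈ Ixy K ^ 3) : pf K 3 * pg K 3 * a * b ∈ symbPow K 3 3 :=
  mem_symbPow.2 ⟨Ideal.mul_mem_right _ _ (triple_mem_Ifg_pow_three (pf_mem_Ifg 3)
      (pg_mem_Ifg 3) ha),
    Ideal.mul_mem_left _ _ hb,
    Ideal.mul_mem_right _ _ (Ideal.mul_mem_right _ _ (Ideal.mul_mem_right _ _ (pf_mem_Iyz_pow 3))),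
    Ideal.mul_mem_right _ _ (Ideal.mul_mem_right _ _ (Ideal.mul_mem_left _ _ (pg_mem_Izx_pow 3)))⟩

/-- The second generator `gf²x³ + hg²y³ + fh²z³` of the reduction. -/
def reductionGenerator (K : Type*) [Field K] : MvPolynomial (Fin 3) K :=
  pg K 3 * pf K 3 ^ 2 * X 0 ^ 3 + ph K 3 * pg K 3 ^ 2 * X 1 ^ 3 + pf K 3 * ph K 3 ^ 2 * X 2 ^ 3

theorem pf_mul_pg_mul_ph_mem_symbPow : pf K 3 * pg K 3 * ph K 3 ∈ symbPow K 3 3 :=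
  mem_symbPow.2 ⟨triple_mem_Ifg_pow_three (pf_mem_Ifg 3) (pg_mem_Ifg 3) (ph_mem_Ifg 3),
    Ideal.mul_mem_left _ _ (ph_mem_Ixy_pow 3),
    Ideal.mul_mem_right _ _ (Ideal.mul_mem_right _ _ (pf_mem_Iyz_pow 3)),
    Ideal.mul_mem_right _ _ (Ideal.mul_mem_left _ _ (pg_mem_Izx_pow 3))⟩

theorem reductionGenerator_mem_symbPow : reductionGenerator K ∈ symbPow K 3 3 := by
  have hx : X 0 ^ 3 ∈ Ixy K ^ 3 := Ideal.pow_mem_pow (Ideal.subset_span (by simp)) _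
  have hy : X 1 ^ 3 ∈ Iyz K ^ 3 := Ideal.pow_mem_pow (Ideal.subset_span (by simp)) _
  have hz : X 2 ^ 3 ∈ Izx K ^ 3 := Ideal.pow_mem_pow (Ideal.subset_span (by simp)) _
  have h₁ := pf_mul_pg_mul_mem_symbPow (pf_mem_Ifg 3) hx
  have h₂ := pg_mul_ph_mul_mem_symbPow (pg_mem_Ifg 3) hy
  have h₃ := ph_mul_pf_mul_mem_symbPow (ph_mem_Ifg 3) hz
  convert Ideal.add_mem _ (Ideal.add_mem _ h₁ h₂) h₃ using 1
  rw [reductionGenerator]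
  ring

theorem mem_symbPow_three_of_mul_mem (hζ : ∃ ζ : K, IsPrimitiveRoot ζ 3)
    {u : MvPolynomial (Fin 3) K} (hu : pf K 3 * pg K 3 * ph K 3 * u ∈ symbPow K 3 6) :
    u ∈ symbPow K 3 3 := by
  obtain ⟨hfg, hxy, hyz, hzx⟩ := mem_symbPow.1 hu
  refine mem_symbPow.2 ⟨?_, ?_, ?_, ?_⟩
  · rw [mul_assoc, mul_assoc] at hfg
    have h₁ := Ideal.mem_span_pair_pow_of_mul_mem (X_cube_sub_X_cube_ne_zero (by decide))
      (isRelPrime_cube_sub_cube hζ (i := 0) (j := 1) (k := 2) (by decide) (by decide) (by decide))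
      hfg
    change _ ∈ Ifg K 3 ^ 5 at h₁
    rw [Ifg_eq_span_pg_ph] at h₁
    have h₂ := Ideal.mem_span_pair_pow_of_mul_mem (X_cube_sub_X_cube_ne_zero (by decide))
      (isRelPrime_cube_sub_cube hζ (i := 1) (j := 2) (k := 0) (by decide) (by decide) (by decide))
      h₁
    change _ ∈ Ideal.span {pg K 3, ph K 3} ^ 4 at h₂
    rw [← Ifg_eq_span_pg_ph, Ifg_eq_span_ph_pf] at h₂
    rw [Ifg_eq_span_ph_pf]
    exact Ideal.mem_span_pair_pow_of_mul_mem (X_cube_sub_X_cube_ne_zero (by decide))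
      (isRelPrime_cube_sub_cube hζ (i := 2) (j := 0) (k := 1) (by decide) (by decide) (by decide))
      h₂
  · rw [show pf K 3 * pg K 3 * ph K 3 * u = ph K 3 * pf K 3 * pg K 3 * u by ring] at hxy
    exact mem_span_X_pair_pow_of_triple_mul_mem hζ (i := 2) (by decide) (by decide) (by decide) hxy
  · exact mem_span_X_pair_pow_of_triple_mul_mem hζ (i := 0) (by decide) (by decide) (by decide) hyz
  · rw [show pf K 3 * pg K 3 * ph K 3 * u = pg K 3 * ph K 3 * pf K 3 * u by ring] at hzx
    exact mem_span_X_pair_pow_of_triple_mul_mem hζ (i := 1) (by decide) (by decide) (by decide) hzx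

theorem exists_eq_reductionGenerator_mul_add (hζ : ∃ ζ : K, IsPrimitiveRoot ζ 3)
    {p : MvPolynomial (Fin 3) K} (hp : p ∈ symbPow K 3 6) :
    ∃ r ∈ symbPow K 3 3, ∃ u ∈ symbPow K 3 3,
      p = reductionGenerator K * r + pf K 3 * pg K 3 * ph K 3 * u := by
  obtain ⟨hfg, hxy, hyz, hzx⟩ := mem_symbPow.1 hp
  obtain ⟨s₁, hs₁, c₁, hc₁⟩ : ∃ s ∈ Iyz K ^ 3, pf K 3 ∣ p - pg K 3 ^ 6 * (X 1 ^ 3 * s) :=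
    exists_restriction_eq (i := 0) (by decide) (by decide) hfg hyz
  obtain ⟨s₂, hs₂, c₂, hc₂⟩ : ∃ s ∈ Izx K ^ 3, pg K 3 ∣ p - ph K 3 ^ 6 * (X 2 ^ 3 * s) := by
    rw [Ifg_eq_span_pg_ph] at hfg
    exact exists_restriction_eq (i := 1) (by decide) (by decide) hfg hzx
  obtain ⟨s₃, hs₃, c₃, hc₃⟩ : ∃ s ∈ Ixy K ^ 3, ph K 3 ∣ p - pf K 3 ^ 6 * (X 0 ^ 3 * s) := by
    rw [Ifg_eq_span_ph_pf] at hfg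
    exact exists_restriction_eq (i := 2) (by decide) (by decide) hfg hxy
  set r := pg K 3 * ph K 3 * pg K 3 * s₁ + ph K 3 * pf K 3 * ph K 3 * s₂ +
    pf K 3 * pg K 3 * pf K 3 * s₃ with hr
  have hr_mem : r ∈ symbPow K 3 3 :=
    Ideal.add_mem _ (Ideal.add_mem _ (pg_mul_ph_mul_mem_symbPow (pg_mem_Ifg 3) hs₁)
      (ph_mul_pf_mul_mem_symbPow (ph_mem_Ifg 3) hs₂))
      (pf_mul_pg_mul_mem_symbPow (pf_mem_Ifg 3) hs₃)
  have hdf : pf K 3 ∣ p - reductionGenerator K * r := by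
    exact dvd_sub_mul_of_add_eq_zero (pf_add_pg_add_ph 3) ⟨c₁, hc₁⟩
  have hdg : pg K 3 ∣ p - reductionGenerator K * r := by
    have := dvd_sub_mul_of_add_eq_zero (x := X 1 ^ 3) (z := X 0 ^ 3) (s₂ := s₃) (s₃ := s₁)
      (b := ph K 3) (c := pf K 3) (by linear_combination pf_add_pg_add_ph (K := K) 3) ⟨c₂, hc₂⟩
    convert this using 1
    rw [hr, reductionGenerator]
    ring
  have hdh : ph K 3 ∣ p - reductionGenerator K * r := by
    have := dvd_sub_mul_of_add_eq_zero (x := X 2 ^ 3) (z := X 1 ^ 3) (s₂ := s₁) (s₃ := s₂)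
      (b := pf K 3) (c := pg K 3) (by linear_combination pf_add_pg_add_ph (K := K) 3) ⟨c₃, hc₃⟩
    convert this using 1
    rw [hr, reductionGenerator]
    ring
  have hfg' : IsRelPrime (pf K 3) (pg K 3) :=
    isRelPrime_cube_sub_cube hζ (i := 0) (by decide) (by decide) (by decide)
  have hgh' : IsRelPrime (pg K 3) (ph K 3) :=
    isRelPrime_cube_sub_cube hζ (i := 1) (by decide) (by decide) (by decide)
  have hhf' : IsRelPrime (ph K 3) (pf K 3) :=
    isRelPrime_cube_sub_cube hζ (i := 2) (by decide) (by decide) (by decide)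
  obtain ⟨u, hu⟩ : pf K 3 * pg K 3 * ph K 3 ∣ p - reductionGenerator K * r :=
    (hhf'.symm.mul_left hgh').mul_dvd (hfg'.mul_dvd hdf hdg) hdh
  refine ⟨r, hr_mem, u, mem_symbPow_three_of_mul_mem hζ ?_, by linear_combination hu⟩
  rw [← hu]
  exact Ideal.sub_mem _ hp (symbPow_mul_symbPow_le 3 3 3
    (Ideal.mul_mem_mul reductionGenerator_mem_symbPow hr_mem))

end Fermat

/-- for `n = 3`, the two-generated ideal
`J = (fgh, gf²x³ + hg²y³ + fh²z³)` satisfies `J·I^{(3)} = I^{(6)} = (I^{(3)})²`, i.e. `J`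
is a homogeneous (minimal) reduction of `I^{(3)}` with reduction number one. -/
theorem fermat_cubic_two_generated_reduction {K : Type*} [Field K]
    (hζ : ∃ ζ : K, IsPrimitiveRoot ζ 3) (hinv : IsUnit (3 : K))
    (J : Ideal (MvPolynomial (Fin 3) K))
    (hJ : J = Ideal.span {pf K 3 * pg K 3 * ph K 3,
      pg K 3 * pf K 3 ^ 2 * X 0 ^ 3 + ph K 3 * pg K 3 ^ 2 * X 1 ^ 3 +
        pf K 3 * ph K 3 ^ 2 * X 2 ^ 3}) :
    J ≤ symbPow K 3 3 ∧ J * symbPow K 3 3 = symbPow K 3 6 ∧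
      symbPow K 3 6 = (symbPow K 3 3) ^ 2 := by
  have hJ' : J = Ideal.span {pf K 3 * pg K 3 * ph K 3, reductionGenerator K} := hJ
  have hJI : J ≤ symbPow K 3 3 := by
    rw [hJ', Ideal.span_le]
    rintro _ (rfl | rfl)
    exacts [pf_mul_pg_mul_ph_mem_symbPow, reductionGenerator_mem_symbPow]
  have hle : symbPow K 3 6 ≤ J * symbPow K 3 3 := by
    intro p hp
    obtain ⟨r, hr, u, hu, rfl⟩ := exists_eq_reductionGenerator_mul_add hζ hp
    rw [hJ']
    exact Ideal.add_mem _ (Ideal.mul_mem_mul (Ideal.subset_span (by simp)) hr)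
      (Ideal.mul_mem_mul (Ideal.subset_span (by simp)) hu)
  have hmul : J * symbPow K 3 3 ≤ symbPow K 3 3 ^ 2 := by
    rw [pow_two]
    exact Ideal.mul_mono_left hJI
  have hsq : symbPow K 3 3 ^ 2 ≤ symbPow K 3 6 := by
    rw [pow_two]
    exact symbPow_mul_symbPow_le 3 3 3
  exact ⟨hJI, le_antisymm (hmul.trans hsq) hle, le_antisymm (hle.trans hmul) hsq⟩
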